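/- Let v₂ be the vector field on ℝ⁷ given by v₂(t,k,n) = (t, t·k₁, t·k₂, t·k₃, (1−t)·n₁, (1−t)·n₂, (1−t)·n₃). On the region where t > 0, all kᵢ > 0 and all nⱼ > 0, the six functions Iᵢ(t,k,n) = ln(kᵢ) − t (i = 1,2,3) and Iⱼ₊₃(t,k,n) = ln(nⱼ/t) + t (j = 1,2,3) satisfy v₂[I] = 0, i.e. the directional derivative of each along v₂ vanishes at every such point. -/

import Mathlib

/-- `ℝ⁷` with coordinates `(t, k₁,k₂,k₃, n₁,n₂,n₃)`. -/
abbrev Space7 : Type := ℝ × (Fin 3 → ℝ) × (Fin 3 → ℝ)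

/-- The vector field
`v₂(t,k,n) = (t, t·k₁, t·k₂, t·k₃, (1−t)·n₁, (1−t)·n₂, (1−t)·n₃)`. -/
noncomputable def v2 (x : Space7) : Space7 :=
  (x.1, fun i => x.1 * x.2.1 i, fun i => (1 - x.1) * x.2.2 i)

theorem hasFDerivAt_time (x : Space7) :
    HasFDerivAt (fun y : Space7 => y.1) (ContinuousLinearMap.fst ℝ ℝ _) x :=
  hasFDerivAt_fst

theorem hasFDerivAt_fst_coord (x : Space7) (i : Fin 3) :
    HasFDerivAt (fun y : Space7 => y.2.1 i)
      ((ContinuousLinearMap.proj (R := ℝ) (φ := fun _ : Fin 3 => ℝ) i).comp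
        ((ContinuousLinearMap.fst ℝ _ _).comp (ContinuousLinearMap.snd ℝ ℝ _))) x :=
  hasFDerivAt_pi'.1 hasFDerivAt_snd.fst i

theorem hasFDerivAt_snd_coord (x : Space7) (j : Fin 3) :
    HasFDerivAt (fun y : Space7 => y.2.2 j)
      ((ContinuousLinearMap.proj (R := ℝ) (φ := fun _ : Fin 3 => ℝ) j).comp
        ((ContinuousLinearMap.snd ℝ _ _).comp (ContinuousLinearMap.snd ℝ ℝ _))) x :=
  hasFDerivAt_pi'.1 hasFDerivAt_snd.snd j

/-- On the region where `t > 0`, all `kᵢ > 0` and all `nⱼ > 0`, the six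
functions `Iᵢ = ln(kᵢ) − t` and `Iⱼ₊₃ = ln(nⱼ/t) + t` satisfy `v₂[I] = 0`. -/
theorem invariants_of_v2 (x : Space7) (ht : 0 < x.1)
    (hkpos : ∀ i : Fin 3, 0 < x.2.1 i) (hnpos : ∀ j : Fin 3, 0 < x.2.2 j) :
    (∀ i : Fin 3,
      fderiv ℝ (fun y : Space7 => Real.log (y.2.1 i) - y.1) x (v2 x) = 0) ∧
    (∀ j : Fin 3,
      fderiv ℝ (fun y : Space7 => Real.log (y.2.2 j / y.1) + y.1) x (v2 x) = 0) := by
  refine ⟨fun i => ?_, fun j => ?_⟩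
  · have hk := (hkpos i).ne'
    rw [(((hasFDerivAt_fst_coord x i).log hk).fun_sub (hasFDerivAt_time x)).fderiv]
    simp [v2]
    field_simp
    ring
  · have hn := (hnpos j).ne'
    have hN := hasFDerivAt_snd_coord x j
    have hT := hasFDerivAt_time x
    have hlog : (fun y : Space7 => Real.log (y.2.2 j / y.1) + y.1) =ᶠ[nhds x]
        fun y => Real.log (y.2.2 j) - Real.log y.1 + y.1 := by
      filter_upwards [hN.continuousAt.eventually_ne hn, hT.continuousAt.eventually_ne ht.ne']
        with y hy₁ hy₂
      rw [Real.log_div hy₁ hy₂]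
    rw [hlog.fderiv_eq, (((hN.log hn).fun_sub (hT.log ht.ne')).fun_add hT).fderiv]
    simp [v2]
    field_simp
    ring
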